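/- Let M be a finite MDP and R ⊆ Z ⊆ Q with Pre^r(R) = R and Pre^r(Z) = Z for some r > 0. If in the product MDP M_Z × [r] (which tracks a position counter modulo r, allows only Z-safe actions, and sends unsafe plays to an absorbing sink) the state ⟨q₀, t⟩ is almost-sure winning for the reachability objective ◇(R × {0}) for some 0 ≤ t < r, then q₀ is almost-sure (hence limit-sure) eventually synchronizing in R with support in Z in M. -/

import Mathlib

open Finset

structure MDP (Q A : Type) [Fintype Q] [Fintype A] where
  δ : Q → A → Q → ℝ
  nonneg : ∀ q a q', 0 ≤ δ q a q'
  sum_one : ∀ q a, ∑ q', δ q a q' = 1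

structure Strat (Q A : Type) [Fintype A] where
  σ : List Q → A → ℝ
  nonneg : ∀ h a, 0 ≤ σ h a
  sum_one : ∀ h, ∑ a, σ h a = 1

variable {Q A : Type} [Fintype Q] [DecidableEq Q] [Fintype A]

/-- Probability of a path of length `n` (i.e. `n+1` states) from initial
distribution `μ0` under strategy `α`. The history passed to the strategy is
the list of visited states, most recent first. -/
noncomputable def pathProb (M : MDP Q A) (μ0 : Q → ℝ) (α : Strat Q A)
    {n : ℕ} (π : Fin (n + 1) → Q) : ℝ :=
  μ0 (π 0) *
    ∏ i : Fin n,
      ∑ a,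
        α.σ (List.ofFn (fun j : Fin (i.1 + 1) =>
            π ⟨i.1 - j.1, lt_of_le_of_lt (Nat.sub_le i.1 j.1) (Nat.lt_succ_of_lt i.isLt)⟩)) a *
          M.δ (π i.castSucc) a (π i.succ)

/-- Distribution over states after `n` steps. -/
noncomputable def Mdist (M : MDP Q A) (μ0 : Q → ℝ) (α : Strat Q A) (n : ℕ) (q : Q) : ℝ :=
  ∑ π : Fin (n + 1) → Q, if π (Fin.last n) = q then pathProb M μ0 α π else 0

/-- Probability mass in `T` after `n` steps. -/
noncomputable def Mmass (M : MDP Q A) (μ0 : Q → ℝ) (α : Strat Q A) (n : ℕ) (T : Finset Q) : ℝ :=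
  ∑ q ∈ T, Mdist M μ0 α n q

open scoped Classical in
/-- Support of the transition `δ(q,a)`. -/
noncomputable def post (M : MDP Q A) (q : Q) (a : A) : Finset Q :=
  Finset.univ.filter (fun q' => 0 < M.δ q a q')

open scoped Classical in
/-- One-step predecessor operator. -/
noncomputable def PreM (M : MDP Q A) (S : Finset Q) : Finset Q :=
  Finset.univ.filter (fun q => ∃ a, post M q a ⊆ S)

def IsDist (μ : Q → ℝ) : Prop := (∀ q, 0 ≤ μ q) ∧ ∑ q, μ q = 1

def dirac (q0 : Q) : Q → ℝ := fun q => if q = q0 then (1 : ℝ) else 0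

def PureStrat (α : Strat Q A) : Prop := ∀ h, ∃ a, α.σ h a = 1

open scoped Classical in
/-- Probability of hitting the target set `Tgt` within the first `n` steps. -/
noncomputable def MhitProb {Q A : Type} [Fintype Q] [DecidableEq Q] [Fintype A]
    (M : MDP Q A) (μ0 : Q → ℝ) (α : Strat Q A) (n : ℕ) (Tgt : Finset Q) : ℝ :=
  ∑ π : Fin (n + 1) → Q, if ∃ i, π i ∈ Tgt then pathProb M μ0 α π else 0

/-- The visited states of a path, most recent first. -/
def pathHist {Q : Type} {n : ℕ} (π : Fin (n + 1) → Q) : List Q :=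
  List.ofFn fun j : Fin (n + 1) =>
    π ⟨n - j.1, lt_of_le_of_lt (Nat.sub_le n j.1) (Nat.lt_succ_self n)⟩

section PathHistory

variable {Q : Type}

theorem pathHist_snoc {n : ℕ} (π : Fin (n + 1) → Q) (q : Q) :
    pathHist (Fin.snoc π q : Fin (n + 1 + 1) → Q) = q :: pathHist π := by
  unfold pathHist
  rw [List.ofFn_succ]
  congr 1
  · exact Fin.snoc_last (α := fun _ => Q) q π
  · congr 1
    funext j
    have : (⟨n + 1 - (j.succ : Fin (n + 2)).1,
        lt_of_le_of_lt (Nat.sub_le _ _) (Nat.lt_succ_self _)⟩ : Fin (n + 2)) =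
        Fin.castSucc ⟨n - j.1, lt_of_le_of_lt (Nat.sub_le n j.1) (Nat.lt_succ_self n)⟩ := by
      ext; simp
    rw [this]
    exact Fin.snoc_castSucc (α := fun _ => Q) q π _

theorem pathHist_eq_cons {n : ℕ} (π : Fin (n + 1) → Q) :
    pathHist π = π (Fin.last n) :: (pathHist π).tail := by
  unfold pathHist
  rw [List.ofFn_succ]
  rfl

theorem length_pathHist {n : ℕ} (π : Fin (n + 1) → Q) : (pathHist π).length = n + 1 := by
  simp [pathHist]

theorem mem_pathHist {n : ℕ} (π : Fin (n + 1) → Q) (q : Q) :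
    q ∈ pathHist π ↔ ∃ i, π i = q := by
  unfold pathHist
  rw [List.mem_ofFn]
  constructor
  · rintro ⟨j, hj⟩
    exact ⟨_, hj⟩
  · rintro ⟨i, hi⟩
    refine ⟨⟨n - i.1, by omega⟩, ?_⟩
    rw [← hi]
    congr 1
    ext
    simp only
    omega

end PathHistory

/-- One-step transition probability after a history (most recent state first). -/
noncomputable def histStep {Q A : Type} [Fintype Q] [Fintype A]
    (M : MDP Q A) (α : Strat Q A) : List Q → Q → ℝ
  | [], _ => 0
  | q :: l, q' => ∑ a, α.σ (q :: l) a * M.δ q a q'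

/-- Expected value of `f` at the history reached `n` steps after a given history. -/
noncomputable def histExp {Q A : Type} [Fintype Q] [Fintype A]
    (M : MDP Q A) (α : Strat Q A) : ℕ → (List Q → ℝ) → List Q → ℝ
  | 0, f, h => f h
  | n + 1, f, h => ∑ q', histStep M α h q' * histExp M α n f (q' :: h)

/-- Indicator of the histories `q :: l` whose current state lies in `S l.length`. -/
noncomputable def headInd {Q : Type} [DecidableEq Q] (S : ℕ → Finset Q) : List Q → ℝ
  | [] => 0
  | q :: l => if q ∈ S l.length then 1 else 0

theorem headInd_nonneg {Q : Type} [DecidableEq Q] (S : ℕ → Finset Q) (h : List Q) : 0 ≤ headInd S h := by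
  cases h with
  | nil => exact le_rfl
  | cons q l => simp only [headInd]; split_ifs <;> norm_num

section HistoryExpectation

variable {Q A : Type} [Fintype Q] [Fintype A] (M : MDP Q A) (α : Strat Q A)

theorem histStep_nonneg (h : List Q) (q' : Q) : 0 ≤ histStep M α h q' := by
  cases h with
  | nil => exact le_rfl
  | cons q l => exact sum_nonneg fun a _ => mul_nonneg (α.nonneg _ _) (M.nonneg _ _ _)

theorem sum_histStep_cons (q : Q) (l : List Q) : ∑ q', histStep M α (q :: l) q' = 1 := by
  simp only [histStep]
  rw [sum_comm]
  simp [← mul_sum, M.sum_one, α.sum_one]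

theorem mem_of_histStep_ne_zero {q q' : Q} {l : List Q} {S : Finset Q}
    (hα : ∀ a, α.σ (q :: l) a ≠ 0 → post M q a ⊆ S) (h : histStep M α (q :: l) q' ≠ 0) :
    q' ∈ S := by
  obtain ⟨a, -, ha⟩ := exists_ne_zero_of_sum_ne_zero h
  refine hα a (left_ne_zero_of_mul ha) ?_
  simp only [post, mem_filter, mem_univ, true_and]
  exact lt_of_le_of_ne (M.nonneg _ _ _) (right_ne_zero_of_mul ha).symm

theorem histExp_mono {f g : List Q → ℝ} (hfg : ∀ h, f h ≤ g h) (n : ℕ) (h : List Q) :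
    histExp M α n f h ≤ histExp M α n g h := by
  induction n generalizing h with
  | zero => exact hfg h
  | succ n ih =>
    exact sum_le_sum fun q' _ => mul_le_mul_of_nonneg_left (ih _) (histStep_nonneg M α h q')

theorem histExp_add (f : List Q → ℝ) (n m : ℕ) (h : List Q) :
    histExp M α (n + m) f h = histExp M α n (histExp M α m f) h := by
  induction n generalizing h with
  | zero => simp [histExp]
  | succ n ih => rw [Nat.succ_add]; simp only [histExp, ih]

/-- If a set of nonempty histories is closed under the transitions and `f = c` on it, then the
expectation of `f` from any history of that set is `c`. -/
theorem histExp_eq_of_invariant {I : Q → List Q → Prop} {f : List Q → ℝ} {c : ℝ}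
    (hf : ∀ q l, I q l → f (q :: l) = c)
    (hI : ∀ q l q', I q l → histStep M α (q :: l) q' ≠ 0 → I q' (q :: l))
    (n : ℕ) {q : Q} {l : List Q} (h : I q l) : histExp M α n f (q :: l) = c := by
  induction n generalizing q l with
  | zero => exact hf q l h
  | succ n ih =>
    have : ∀ q', histStep M α (q :: l) q' * histExp M α n f (q' :: q :: l) =
        histStep M α (q :: l) q' * c := by
      intro q'
      by_cases h0 : histStep M α (q :: l) q' = 0
      · simp [h0]
      · rw [ih (hI q l q' h h0)]
    simp only [histExp, this]
    rw [← sum_mul, sum_histStep_cons, one_mul]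

theorem histExp_le_one {f : List Q → ℝ} (hf : ∀ h, f h ≤ 1) (n : ℕ) (q : Q) (l : List Q) :
    histExp M α n f (q :: l) ≤ 1 := by
  refine (histExp_mono M α hf n _).trans_eq ?_
  exact histExp_eq_of_invariant M α (I := fun _ _ => True) (fun _ _ _ => rfl)
    (fun _ _ _ _ _ => trivial) n trivial

theorem histExp_nonneg {f : List Q → ℝ} (hf : ∀ h, 0 ≤ f h) (n : ℕ) (h : List Q) :
    0 ≤ histExp M α n f h := by
  induction n generalizing h with
  | zero => exact hf h
  | succ n ih => exact sum_nonneg fun q' _ => mul_nonneg (histStep_nonneg M α h q') (ih _)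

theorem pathProb_snoc [DecidableEq Q] (μ0 : Q → ℝ) {n : ℕ} (π : Fin (n + 1) → Q) (q : Q) :
    pathProb M μ0 α (Fin.snoc π q : Fin (n + 1 + 1) → Q) =
      pathProb M μ0 α π * histStep M α (pathHist π) q := by
  have hs : ∀ (k : ℕ) (hk : k < n + 1) (hk' : k < n + 1 + 1),
      (Fin.snoc π q : Fin (n + 1 + 1) → Q) ⟨k, hk'⟩ = π ⟨k, hk⟩ := fun k hk _ =>
    Fin.snoc_castSucc (α := fun _ => Q) q π ⟨k, hk⟩
  have h0 : (Fin.snoc π q : Fin (n + 1 + 1) → Q) 0 = π 0 := hs 0 (by omega) (by omega)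
  unfold pathProb
  rw [Fin.prod_univ_castSucc, ← mul_assoc, h0]
  congr 1
  · congr 1
    refine prod_congr rfl fun i _ => sum_congr rfl fun a _ => ?_
    have e1 : (Fin.snoc π q : Fin (n + 1 + 1) → Q) i.castSucc.castSucc = π i.castSucc :=
      Fin.snoc_castSucc (α := fun _ => Q) q π _
    have e2 : (Fin.snoc π q : Fin (n + 1 + 1) → Q) i.castSucc.succ = π i.succ :=
      hs (i.1 + 1) (by omega) (by omega)
    rw [e1, e2]
    congr 2
    congr 1
    funext j
    exact hs _ _ _
  · have e1 : (Fin.snoc π q : Fin (n + 1 + 1) → Q) (Fin.last n).castSucc = π (Fin.last n) :=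
      Fin.snoc_castSucc (α := fun _ => Q) q π _
    have e2 : (Fin.snoc π q : Fin (n + 1 + 1) → Q) (Fin.last n).succ = q :=
      Fin.snoc_last (α := fun _ => Q) q π
    have e3 : (List.ofFn fun j : Fin (n + 1) => (Fin.snoc π q : Fin (n + 1 + 1) → Q)
        ⟨n - j.1, by omega⟩) = pathHist π := by
      unfold pathHist
      congr 1
      funext j
      exact hs _ _ _
    have e4 : histStep M α (pathHist π) q =
        ∑ a, α.σ (pathHist π) a * M.δ (π (Fin.last n)) a q := by
      rw [pathHist_eq_cons π]
      rfl
    rw [e1, e2, e4, ← e3]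
    rfl

theorem sum_pathProb_mul [DecidableEq Q] (μ0 : Q → ℝ) (n : ℕ) (f : List Q → ℝ) :
    ∑ π : Fin (n + 1) → Q, pathProb M μ0 α π * f (pathHist π) =
      ∑ q, μ0 q * histExp M α n f [q] := by
  induction n generalizing f with
  | zero =>
    rw [← (Equiv.funUnique (Fin 1) Q).symm.sum_comp]
    simp [pathProb, histExp, pathHist]
  | succ n ih =>
    have h1 : ∀ h, histExp M α 1 f h = ∑ q', histStep M α h q' * f (q' :: h) := fun _ => rfl
    rw [← (Fin.snocEquiv fun _ : Fin (n + 1 + 1) => Q).sum_comp, Fintype.sum_prod_type, sum_comm]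
    simp only [histExp_add M α f n 1]
    rw [← ih]
    refine sum_congr rfl fun π _ => ?_
    rw [h1, mul_sum]
    refine sum_congr rfl fun q _ => ?_
    have e : (Fin.snocEquiv fun _ : Fin (n + 1 + 1) => Q) (q, π) =
        (Fin.snoc π q : Fin (n + 1 + 1) → Q) := rfl
    rw [e, pathProb_snoc, pathHist_snoc, mul_assoc]

theorem sum_pathProb_dirac_mul [DecidableEq Q] (q0 : Q) (n : ℕ) (f : List Q → ℝ) :
    ∑ π : Fin (n + 1) → Q, pathProb M (dirac q0) α π * f (pathHist π) =
      histExp M α n f [q0] := by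
  rw [sum_pathProb_mul]
  simp [dirac]

open scoped Classical in
theorem MhitProb_eq_histExp [DecidableEq Q] (q0 : Q) (n : ℕ) (T : Finset Q) :
    MhitProb M (dirac q0) α n T =
      histExp M α n (fun h => if ∃ q ∈ h, q ∈ T then 1 else 0) [q0] := by
  rw [← sum_pathProb_dirac_mul]
  refine sum_congr rfl fun π _ => ?_
  have : (∃ q ∈ pathHist π, q ∈ T) ↔ ∃ i, π i ∈ T := by
    simp only [mem_pathHist]
    constructor
    · rintro ⟨q, ⟨i, rfl⟩, h⟩
      exact ⟨i, h⟩
    · rintro ⟨i, h⟩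
      exact ⟨_, ⟨i, rfl⟩, h⟩
  simp [this]

theorem Mmass_eq_histExp [DecidableEq Q] (q0 : Q) (n : ℕ) (S : ℕ → Finset Q) :
    Mmass M (dirac q0) α n (S n) = histExp M α n (headInd S) [q0] := by
  rw [← sum_pathProb_dirac_mul]
  unfold Mmass Mdist
  rw [sum_comm]
  refine sum_congr rfl fun π _ => ?_
  have hl : (pathHist π).tail.length = n := by simp [length_pathHist]
  rw [pathHist_eq_cons π]
  simp [headInd, hl]

end HistoryExpectation

section Predecessor

variable {Q A : Type} [Fintype Q] [DecidableEq Q] [Fintype A] (M : MDP Q A)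

theorem PreM_mono {S T : Finset Q} (h : S ⊆ T) : PreM M S ⊆ PreM M T := by
  intro q
  simp only [PreM, mem_filter, mem_univ, true_and]
  rintro ⟨a, ha⟩
  exact ⟨a, ha.trans h⟩

theorem PreM_iterate_mono {S T : Finset Q} (h : S ⊆ T) (n : ℕ) :
    (PreM M)^[n] S ⊆ (PreM M)^[n] T :=
  Monotone.iterate (f := PreM M) (fun _ _ => PreM_mono M) n h

theorem mem_PreM_iterate_iff_of_periodic {S : Finset Q} {r : ℕ} (hS : (PreM M)^[r] S = S)
    {i : ℕ} (hi : i < r) (q : Q) :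
    q ∈ (PreM M)^[i] S ↔ ∃ a, post M q a ⊆ (PreM M)^[(i + r - 1) % r] S := by
  have key : (PreM M)^[i] S = PreM M ((PreM M)^[(i + r - 1) % r] S) := by
    cases i with
    | zero =>
      obtain ⟨k, rfl⟩ : ∃ k, r = k + 1 := ⟨r - 1, by omega⟩
      have : (0 + (k + 1) - 1) % (k + 1) = k := by
        rw [show 0 + (k + 1) - 1 = k by omega]; exact Nat.mod_eq_of_lt (by omega)
      rw [this, ← Function.iterate_succ_apply' (PreM M), hS]
      rfl
    | succ k =>
      have : (k + 1 + r - 1) % r = k := by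
        rw [show k + 1 + r - 1 = k + r by omega, Nat.add_mod_right]
        exact Nat.mod_eq_of_lt (by omega)
      rw [this, ← Function.iterate_succ_apply' (PreM M)]
  rw [key]
  simp [PreM]

end Predecessor

open scoped Classical in
/-- A distribution can be moved onto a nonempty set without decreasing any weight there. -/
theorem exists_dist_supported {A : Type} [Fintype A] {w : A → ℝ} (hw : ∀ a, 0 ≤ w a)
    (hw1 : ∑ a, w a = 1) {P : A → Prop} (hP : ∃ a, P a) :
    ∃ v : A → ℝ, (∀ a, 0 ≤ v a) ∧ ∑ a, v a = 1 ∧ (∀ a, v a ≠ 0 → P a) ∧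
      ∀ a, P a → w a ≤ v a := by
  obtain ⟨b, hb⟩ := hP
  have hc : 0 ≤ ∑ a, if P a then 0 else w a :=
    sum_nonneg fun a _ => by split_ifs <;> simp [hw]
  refine ⟨fun a => (if P a then w a else 0) +
    if a = b then ∑ a, (if P a then 0 else w a) else 0, ?_, ?_, ?_, ?_⟩
  · intro a
    have := hw a
    dsimp only
    split_ifs <;> linarith
  · rw [sum_add_distrib, sum_ite_eq' univ b, if_pos (mem_univ b), ← sum_add_distrib, ← hw1]
    refine sum_congr rfl fun a _ => ?_
    split_ifs <;> simp
  · intro a ha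
    by_contra hPa
    have : a ≠ b := fun h => hPa (h ▸ hb)
    simp [hPa, this] at ha
  · intro a ha
    dsimp only
    rw [if_pos ha]
    split_ifs <;> linarith

/-- The position counter, started at `t`, after `n` decrements modulo `r`. -/
def counter {r : ℕ} (hr : 0 < r) (t : Fin r) (n : ℕ) : Fin r :=
  ⟨(t.1 + n * (r - 1)) % r, Nat.mod_lt _ hr⟩

theorem counter_zero {r : ℕ} (hr : 0 < r) (t : Fin r) : counter hr t 0 = t := by
  ext
  simp [counter, Nat.mod_eq_of_lt t.isLt]

theorem counter_succ {r : ℕ} (hr : 0 < r) (t : Fin r) (n : ℕ) :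
    (counter hr t (n + 1)).1 = ((counter hr t n).1 + r - 1) % r := by
  simp only [counter]
  rw [Nat.add_sub_assoc hr, Nat.mod_add_mod]
  congr 1
  ring

theorem counter_add_mul {r : ℕ} (hr : 0 < r) (t : Fin r) (n : ℕ) :
    (counter hr t (t.1 + n * r)).1 = 0 := by
  obtain ⟨k, rfl⟩ : ∃ k, r = k + 1 := ⟨r - 1, by omega⟩
  simp only [counter, Nat.add_sub_cancel]
  have : t.1 + (t.1 + n * (k + 1)) * k = (k + 1) * (t.1 + n * k) := by ring
  rw [this, Nat.mul_mod_right]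

/-- The history of the product MDP obtained by recording the position counter. -/
def annotate {Q : Type} {r : ℕ} (c : ℕ → Fin r) : List Q → List (Option (Q × Fin r))
  | [] => []
  | q :: l => some (q, c l.length) :: annotate c l

/-- Let `R ⊆ Z ⊆ Q` with `Pre^r(R) = R` and `Pre^r(Z) = Z`, `r > 0`. Let `N` be the
product MDP `M_Z × [r]` over states `Q × {0,…,r−1} ∪ {sink}`: it tracks a position
counter decremented modulo `r`, allows only `Z`-safe actions (an action `a` is
`Z`-safe at position `i` if `post(q,a) ⊆ Pre^{(i−1) mod r}(Z)`), and sends unsafe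
plays to the absorbing sink. If for some position `t` the state `⟨q₀,t⟩` is
almost-sure winning in `N` for the reachability objective `◇(R × {0})`, then in
`M` the state `q₀` is almost-sure (hence limit-sure) eventually synchronizing in
`R` with support in `Z`. -/
theorem product_reachability_implies_sync {Q A : Type} [Fintype Q] [DecidableEq Q]
    [Fintype A] [Nonempty Q] [Nonempty A]
    (M : MDP Q A) (R Z : Finset Q) (hRZ : R ⊆ Z) (r : ℕ) (hr : 0 < r)
    (hfixR : (PreM M)^[r] R = R) (hfixZ : (PreM M)^[r] Z = Z)
    (N : MDP (Option (Q × Fin r)) A)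
    (hN : N.δ = fun s a s' =>
      match s with
      | none => if s' = none then (1 : ℝ) else 0
      | some (q, i) =>
        if post M q a ⊆ (PreM M)^[(i.1 + r - 1) % r] Z then
          (match s' with
           | some (q', j) => if j.1 = (i.1 + r - 1) % r then M.δ q a q' else 0
           | none => 0)
        else if s' = none then 1 else 0)
    (q0 : Q) (t : Fin r)
    (hreach : ∃ α' : Strat (Option (Q × Fin r)) A,
      ∀ ε : ℝ, 0 < ε → ∃ n : ℕ,
        1 - ε ≤ MhitProb N (dirac (some (q0, t))) α' n
          (R.image (fun q => some (q, (⟨0, hr⟩ : Fin r))))) :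
    ∃ α : Strat Q A, ∀ ε : ℝ, 0 < ε → ∃ n : ℕ,
      1 - ε ≤ Mmass M (dirac q0) α n R ∧ Mmass M (dirac q0) α n Z = 1 := by
  classical
  obtain ⟨α', hα'⟩ := hreach
  set c : ℕ → Fin r := counter hr t with hc
  set T : Finset (Option (Q × Fin r)) :=
    R.image (fun q => some (q, (⟨0, hr⟩ : Fin r))) with hT
  set hit : List (Option (Q × Fin r)) → ℝ := fun h => if ∃ q ∈ h, q ∈ T then 1 else 0 with hhit
  let PR : ℕ → Finset Q := fun n => (PreM M)^[(c n).1] R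
  let PZ : ℕ → Finset Q := fun n => (PreM M)^[(c n).1] Z
  have hPRZ : ∀ n, PR n ⊆ PZ n := fun n => PreM_iterate_mono M hRZ _
  have safeR : ∀ n q, q ∈ PR n ↔ ∃ a, post M q a ⊆ PR (n + 1) := fun n q => by
    simp only [PR, hc, counter_succ]
    exact mem_PreM_iterate_iff_of_periodic M hfixR (counter hr t n).isLt q
  have safeZ : ∀ n q, q ∈ PZ n ↔ ∃ a, post M q a ⊆ PZ (n + 1) := fun n q => by
    simp only [PZ, hc, counter_succ]
    exact mem_PreM_iterate_iff_of_periodic M hfixZ (counter hr t n).isLt q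
  have memT : ∀ n q, some (q, c n) ∈ T → q ∈ PR n := by
    intro n q h
    obtain ⟨q', hq', he⟩ := mem_image.1 h
    simp only [Option.some.injEq, Prod.mk.injEq] at he
    obtain ⟨rfl, hcn⟩ := he
    change q' ∈ (PreM M)^[(c n).1] R
    rw [← hcn]
    exact hq'
  have noneT : none ∉ T := by simp [hT]
  have hNsome : ∀ q n a q' j, N.δ (some (q, c n)) a (some (q', j)) =
      if post M q a ⊆ PZ (n + 1) ∧ j = c (n + 1) then M.δ q a q' else 0 := by
    intro q n a q' j
    simp only [hN, PZ, Fin.ext_iff, hc, counter_succ]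
    split_ifs <;> simp_all
  have hit_sink : ∀ n l, (∀ x ∈ l, x ∉ T) → histExp N α' n hit (none :: l) = 0 := by
    intro n l hl
    refine histExp_eq_of_invariant N α' (I := fun q l => q = none ∧ ∀ x ∈ l, x ∉ T) ?_ ?_ n
      ⟨rfl, hl⟩
    · rintro q l ⟨rfl, hl⟩
      simp only [hhit]
      rw [if_neg]
      rintro ⟨x, hx, hxT⟩
      rcases List.mem_cons.1 hx with rfl | hx
      exacts [noneT hxT, hl x hx hxT]
    · rintro q l q' ⟨rfl, hl⟩ hstep
      refine ⟨?_, ?_⟩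
      · by_contra hq'
        exact hstep (by simp [histStep, hN, hq'])
      · intro x hx
        rcases List.mem_cons.1 hx with rfl | hx
        exacts [noneT, hl x hx]
  have hit_le : ∀ h, hit h ≤ 1 := fun h => by simp only [hhit]; split_ifs <;> norm_num
  have choice : ∀ h : List Q, ∃ w : A → ℝ, (∀ a, 0 ≤ w a) ∧ ∑ a, w a = 1 ∧
      ∀ q l, h = q :: l →
        (q ∈ PR l.length → ∀ a, w a ≠ 0 → post M q a ⊆ PR (l.length + 1)) ∧
        (q ∈ PZ l.length → ∀ a, w a ≠ 0 → post M q a ⊆ PZ (l.length + 1)) ∧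
        (q ∉ PR l.length → ∀ a, post M q a ⊆ PZ (l.length + 1) →
          α'.σ (annotate c h) a ≤ w a) := by
    intro h
    have h0 := α'.nonneg (annotate c h)
    have h1 := α'.sum_one (annotate c h)
    cases h with
    | nil => exact ⟨_, h0, h1, fun q l h => absurd h (by simp)⟩
    | cons q l =>
      by_cases hR : q ∈ PR l.length
      · obtain ⟨v, v0, v1, vP, -⟩ := exists_dist_supported h0 h1 ((safeR _ _).1 hR)
        refine ⟨v, v0, v1, ?_⟩
        rintro q l ⟨⟩
        exact ⟨fun _ => vP, fun _ a ha => (vP a ha).trans (hPRZ _), fun h => absurd hR h⟩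
      · by_cases hZ : q ∈ PZ l.length
        · obtain ⟨v, v0, v1, vP, vle⟩ := exists_dist_supported h0 h1 ((safeZ _ _).1 hZ)
          refine ⟨v, v0, v1, ?_⟩
          rintro q l ⟨⟩
          exact ⟨fun h => absurd h hR, fun _ => vP, fun _ => vle⟩
        · refine ⟨_, h0, h1, ?_⟩
          rintro q l ⟨⟩
          exact ⟨fun h => absurd h hR, fun h => absurd h hZ, fun _ _ _ => le_rfl⟩
  choose w w0 w1 hw using choice
  let β : Strat Q A := ⟨w, w0, w1⟩
  have stay : ∀ S : ℕ → Finset Q,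
      (∀ q l, q ∈ S l.length → ∀ a, w (q :: l) a ≠ 0 → post M q a ⊆ S (l.length + 1)) →
      ∀ n q l, q ∈ S l.length → histExp M β n (headInd S) (q :: l) = 1 := by
    intro S hS n q l hq
    refine histExp_eq_of_invariant M β (I := fun q l => q ∈ S l.length) ?_ ?_ n hq
    · intro q l h
      simp [headInd, h]
    · intro q l q' h hstep
      exact mem_of_histStep_ne_zero M β (hS q l h) hstep
  have stayR := stay PR fun q l => (hw (q :: l) q l rfl).1
  have stayZ := stay PZ fun q l => (hw (q :: l) q l rfl).2.1
  have compare : ∀ n q l, (∀ x ∈ annotate c l, x ∉ T) →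
      histExp N α' n hit (annotate c (q :: l)) ≤ histExp M β n (headInd PR) (q :: l) := by
    intro n
    induction n with
    | zero =>
      intro q l hl
      by_cases hq : q ∈ PR l.length
      · rw [stayR 0 q l hq]
        exact hit_le _
      · refine le_trans (le_of_eq ?_) (headInd_nonneg PR (q :: l))
        simp only [histExp, hhit]
        rw [if_neg]
        rintro ⟨x, hx, hxT⟩
        rcases List.mem_cons.1 hx with rfl | hx
        exacts [hq (memT _ _ hxT), hl x hx hxT]
    | succ n ih =>
      intro q l hl
      by_cases hq : q ∈ PR l.length
      · rw [stayR _ q l hq]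
        exact histExp_le_one N α' hit_le _ _ _
      · have hl' : ∀ x ∈ annotate c (q :: l), x ∉ T := by
          intro x hx
          rcases List.mem_cons.1 hx with rfl | hx
          exacts [fun h => hq (memT _ _ h), hl x hx]
        simp only [histExp]
        rw [Fintype.sum_option, hit_sink n _ hl', mul_zero, zero_add, Fintype.sum_prod_type]
        refine sum_le_sum fun q' _ => ?_
        rw [sum_eq_single (c (l.length + 1))]
        · refine mul_le_mul ?_ (ih q' (q :: l) hl') ?_ (histStep_nonneg _ _ _ _)
          · simp only [histStep, annotate, hNsome]
            refine sum_le_sum fun a _ => ?_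
            split_ifs with ha
            · exact mul_le_mul_of_nonneg_right ((hw (q :: l) q l rfl).2.2 hq a ha.1)
                (M.nonneg _ _ _)
            · rw [mul_zero]
              exact mul_nonneg (w0 _ _) (M.nonneg _ _ _)
          · exact histExp_nonneg N α' (fun h => by simp only [hhit]; split_ifs <;> norm_num) _ _
        · intro j _ hj
          simp [histStep, annotate, hNsome, hj]
        · simp
  have hq0 : q0 ∈ PZ 0 := by
    by_contra hq0
    have hno : ∀ a, ¬ post M q0 a ⊆ PZ 1 := fun a ha => hq0 ((safeZ 0 q0).2 ⟨a, ha⟩)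
    have ht : some (q0, c 0) ∉ T := fun h => hq0 (hPRZ 0 (memT 0 q0 h))
    have hzero : ∀ n, histExp N α' n hit [some (q0, c 0)] = 0 := by
      intro n
      cases n with
      | zero => simp [histExp, hhit, ht]
      | succ n =>
        simp only [histExp]
        rw [Fintype.sum_option, hit_sink n _ (by simpa using ht)]
        simp [histStep, hNsome, hno]
    obtain ⟨n, hn⟩ := hα' (1 / 2) (by norm_num)
    rw [MhitProb_eq_histExp] at hn
    have := hzero n
    rw [hc, counter_zero] at this
    rw [this] at hn
    norm_num at hn
  refine ⟨β, fun ε hε => ?_⟩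
  obtain ⟨n, hn⟩ := hα' ε hε
  obtain ⟨m, hm⟩ : ∃ m, t.1 + n * r = n + m :=
    Nat.exists_eq_add_of_le ((Nat.le_mul_of_pos_right n hr).trans (Nat.le_add_left _ _))
  have hk : (c (n + m)).1 = 0 := by rw [← hm]; exact counter_add_mul hr t n
  have hRk : PR (n + m) = R := by simp [PR, hk]
  have hZk : PZ (n + m) = Z := by simp [PZ, hk]
  refine ⟨n + m, ?_, ?_⟩
  · rw [← hRk, Mmass_eq_histExp, histExp_add]
    calc 1 - ε ≤ histExp N α' n hit [some (q0, t)] := by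
          rwa [MhitProb_eq_histExp] at hn
      _ = histExp N α' n hit (annotate c [q0]) := by
          simp [annotate, hc, counter_zero]
      _ ≤ histExp M β n (headInd PR) [q0] := compare n q0 [] (by simp [annotate])
      _ ≤ _ := by
          refine histExp_mono M β (fun h => ?_) n _
          cases h with
          | nil => exact histExp_nonneg M β (headInd_nonneg PR) m []
          | cons q l =>
            by_cases hq : q ∈ PR l.length
            · rw [stayR m q l hq]
              simp [headInd, hq]
            · simp only [headInd, if_neg hq]
              exact histExp_nonneg M β (headInd_nonneg PR) m _
  · rw [← hZk, Mmass_eq_histExp]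
    exact stayZ _ q0 [] hq0
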